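/- Let $0<\beta<d$, $f\in W^{1,1}_{\mathrm{pol}}(\mathbb{S}^d)$ and $\{f_j\}_{j\in\mathbb{N}}\subset W^{1,1}_{\mathrm{pol}}(\mathbb{S}^d)$ with $\|f-f_j\|_{W^{1,1}(\mathbb{S}^d)}\to 0$ as $j\to\infty$. For every $\xi\in\mathbb{S}^d$ choose best balls $\overline{\mathcal{B}(\zeta_j,r_j)}\in\mathbf{B}^{\beta}_{\xi,j}$ for $f_j$. Then for almost every $\xi$, if $(\zeta,r)$ is an accumulation point of the sequence $\{(\zeta_j,r_j)\}_{j\in\mathbb{N}}$, the ball $\overline{\mathcal{B}(\zeta,r)}$ belongs to $\mathbf{B}^{\beta}_{\xi}$, the set of best balls for $f$. -/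

import Mathlib

open MeasureTheory Metric Filter Topology Asymptotics
open scoped ENNReal RealInnerProductSpace NNReal

noncomputable section

/-- Euclidean space `ℝⁿ`. -/
abbrev Euc (n : ℕ) : Type := EuclideanSpace ℝ (Fin n)

/-- The unit sphere `𝕊^d ⊆ ℝ^(d+1)`. -/
abbrev Sph (d : ℕ) : Type := Metric.sphere (0 : Euc (d + 1)) 1

/-- The north pole `𝐞 = (1,0,…,0)`. -/
def npole (d : ℕ) : Sph d :=
  ⟨EuclideanSpace.single 0 1, by
    rw [mem_sphere_zero_iff_norm, EuclideanSpace.norm_single]; norm_num⟩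

/-- The south pole `-𝐞`. -/
def spole (d : ℕ) : Sph d :=
  ⟨-(npole d : Euc (d + 1)), by
    rw [mem_sphere_zero_iff_norm, norm_neg, ← mem_sphere_zero_iff_norm]
    exact (npole d).2⟩

/-- Geodesic distance on the sphere. -/
def geodist {d : ℕ} (ξ η : Sph d) : ℝ :=
  Real.arccos ⟪(ξ : Euc (d + 1)), (η : Euc (d + 1))⟫

/-- Open geodesic ball. -/
def gball {d : ℕ} (ζ : Sph d) (r : ℝ) : Set (Sph d) := {η | geodist ζ η < r}

/-- Closed geodesic ball. -/
def gcball {d : ℕ} (ζ : Sph d) (r : ℝ) : Set (Sph d) := {η | geodist ζ η ≤ r}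

/-- Geodesic sphere (boundary of a geodesic ball). -/
def gsphere {d : ℕ} (ζ : Sph d) (r : ℝ) : Set (Sph d) := {η | geodist ζ η = r}

/-- The surface measure `σ` on `𝕊^d`, as the `d`-dimensional Hausdorff measure. -/
def sphMeasure (d : ℕ) : Measure (Sph d) :=
  Measure.comap Subtype.val (MeasureTheory.Measure.hausdorffMeasure (d : ℝ))

/-- The `(d-1)`-dimensional Hausdorff measure on `𝕊^d` (surface measure of boundaries of
geodesic balls). -/
def sphBdry (d : ℕ) : Measure (Sph d) :=
  Measure.comap Subtype.val (MeasureTheory.Measure.hausdorffMeasure ((d : ℝ) - 1))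

/-- Polar angle `θ(ξ) = d(𝐞, ξ)`. -/
def polarAngle {d : ℕ} (ξ : Sph d) : ℝ := geodist (npole d) ξ

/-- `w(ξ) = min{θ(ξ), π - θ(ξ)}`. -/
def sphWidth {d : ℕ} (ξ : Sph d) : ℝ := min (polarAngle ξ) (Real.pi - polarAngle ξ)

/-- A function on the sphere is polar if it only depends on `ξ ⬝ 𝐞`. -/
def IsPolar {d : ℕ} (f : Sph d → ℝ) : Prop :=
  ∀ ξ η : Sph d,
    ⟪(ξ : Euc (d + 1)), (npole d : Euc (d + 1))⟫ =
      ⟪(η : Euc (d + 1)), (npole d : Euc (d + 1))⟫ → f ξ = f η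

/-- The uncentered fractional Hardy–Littlewood maximal function `𝓜̃_β f` on `𝕊^d`. -/
def sphMax {d : ℕ} (β : ℝ) (f : Sph d → ℝ) (ξ : Sph d) : ℝ :=
  sSup {a | ∃ ζ : Sph d, ∃ r : ℝ, 0 < r ∧ r ≤ Real.pi ∧ geodist ζ ξ ≤ r ∧
    a = r ^ β * ⨍ η in gball ζ r, |f η| ∂(sphMeasure d)}

/-- The closed ball `B̄(ζ,r)` is a best ball for `𝓜̃_β f` at `ξ`, i.e. it contains `ξ` and
realizes the supremum defining `𝓜̃_β f (ξ)`. -/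
def IsBestBall {d : ℕ} (β : ℝ) (f : Sph d → ℝ) (ξ ζ : Sph d) (r : ℝ) : Prop :=
  0 ≤ r ∧ r ≤ Real.pi ∧ geodist ζ ξ ≤ r ∧
    sphMax β f ξ = r ^ β * ⨍ η in gball ζ r, |f η| ∂(sphMeasure d)

/-- Projection onto the tangent space of the sphere at `η`. -/
def tangProj {d : ℕ} (η : Sph d) (v : Euc (d + 1)) : Euc (d + 1) :=
  v - ⟪v, (η : Euc (d + 1))⟫ • (η : Euc (d + 1))

/-- `g` is the weak (tangential) gradient of `f` on `𝕊^d`: `g` is a.e. tangent and the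
integration-by-parts formula against restrictions of smooth test functions holds. -/
def HasWeakGrad {d : ℕ} (f : Sph d → ℝ) (g : Sph d → Euc (d + 1)) : Prop :=
  (∀ᵐ η ∂(sphMeasure d), ⟪g η, (η : Euc (d + 1))⟫ = 0) ∧
  ∀ φ : Euc (d + 1) → ℝ, ContDiff ℝ (⊤ : ℕ∞) φ →
    ∫ η, φ (η : Euc (d + 1)) • g η ∂(sphMeasure d)
      = - ∫ η, f η • tangProj η (gradient φ (η : Euc (d + 1))) ∂(sphMeasure d)
        + (d : ℝ) • ∫ η, (f η * φ (η : Euc (d + 1))) • (η : Euc (d + 1)) ∂(sphMeasure d)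

/-- `f ∈ W^{1,1}(𝕊^d)`, with weak gradient `g`. -/
def MemW11 {d : ℕ} (f : Sph d → ℝ) (g : Sph d → Euc (d + 1)) : Prop :=
  Integrable f (sphMeasure d) ∧ Integrable g (sphMeasure d) ∧ HasWeakGrad f g

/-- Convergence `f_j → f` in `W^{1,1}(𝕊^d)` (with weak gradients `g_j, g`). -/
def W11Tendsto {d : ℕ} (fj : ℕ → Sph d → ℝ) (gj : ℕ → Sph d → Euc (d + 1))
    (f : Sph d → ℝ) (g : Sph d → Euc (d + 1)) : Prop :=
  Tendsto (fun j => (∫ ξ, |fj j ξ - f ξ| ∂(sphMeasure d)) +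
    ∫ ξ, ‖gj j ξ - g ξ‖ ∂(sphMeasure d)) atTop (nhds 0)

/-- `u : 𝕊^d → ℝ` is differentiable at `ξ` with (tangential) gradient `G`. -/
def HasSphereGradAt {d : ℕ} (u : Sph d → ℝ) (G : Euc (d + 1)) (ξ : Sph d) : Prop :=
  ⟪G, (ξ : Euc (d + 1))⟫ = 0 ∧
    (fun η : Sph d => u η - u ξ - ⟪G, (η : Euc (d + 1)) - (ξ : Euc (d + 1))⟫)
      =o[nhds ξ] (fun η : Sph d => dist η ξ)

/-- The unit tangent vector at `η` pointing in the direction of the geodesic from `η` to `ζ`: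
`v(η,ζ) = (ζ - (η·ζ)η)/|ζ - (η·ζ)η|`. -/
def gdir {d : ℕ} (η ζ : Sph d) : Euc (d + 1) :=
  ‖(ζ : Euc (d + 1)) - ⟪(η : Euc (d + 1)), (ζ : Euc (d + 1))⟫ • (η : Euc (d + 1))‖⁻¹ •
    ((ζ : Euc (d + 1)) - ⟪(η : Euc (d + 1)), (ζ : Euc (d + 1))⟫ • (η : Euc (d + 1)))

/-- `S(η) = (η·v(ξ,𝐞))ξ - (η·ξ)v(ξ,𝐞)`. -/
def Svec {d : ℕ} (ξ η : Sph d) : Euc (d + 1) :=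
  ⟪(η : Euc (d + 1)), gdir ξ (npole d)⟫ • (ξ : Euc (d + 1)) -
    ⟪(η : Euc (d + 1)), (ξ : Euc (d + 1))⟫ • gdir ξ (npole d)

/-- `ζ` lies on the (closed) half great circle determined by `𝐞`, `ξ` and `-𝐞`
(the one passing through `ξ`). -/
def OnHalfGreatCircle {d : ℕ} (ξ ζ : Sph d) : Prop :=
  ∃ a b : ℝ, 0 ≤ b ∧ (ζ : Euc (d + 1)) = a • (npole d : Euc (d + 1)) +
    b • ((ξ : Euc (d + 1)) -
      ⟪(ξ : Euc (d + 1)), (npole d : Euc (d + 1))⟫ • (npole d : Euc (d + 1)))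

/-- `σ(r)` up to the constant `κ_{d-1}`: `∫₀^r (sin t)^{d-1} dt`. -/
def sinInt (d : ℕ) (r : ℝ) : ℝ := ∫ t in (0:ℝ)..r, (Real.sin t) ^ (d - 1)

/-- `σ'(r)` up to the constant `κ_{d-1}`: `(sin r)^{d-1}`. -/
def sinPow (d : ℕ) (r : ℝ) : ℝ := (Real.sin r) ^ (d - 1)

lemma sph_apply {d : ℕ} (s : Set (Sph d)) :
    sphMeasure d s = Measure.hausdorffMeasure (d : ℝ) (Subtype.val '' s) := by
  unfold sphMeasure
  exact (MeasurableEmbedding.subtype_coe (Metric.isClosed_sphere.measurableSet)).comap_apply _ _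

lemma sph_eq {d : ℕ} : sphMeasure d = Measure.hausdorffMeasure (d : ℝ) := by
  ext s _
  rw [sph_apply]
  exact isometry_subtype_coe.hausdorffMeasure_image (Or.inl (Nat.cast_nonneg d)) s

lemma sph_norm {d : ℕ} (x : Sph d) : ‖(x : Euc (d+1))‖ = 1 := by
  simpa using x.2

lemma sph_inner_self {d : ℕ} (x : Sph d) : ⟪(x : Euc (d+1)), (x : Euc (d+1))⟫ = 1 := by
  rw [real_inner_self_eq_norm_sq, sph_norm]; norm_num

lemma sph_dist_sq {d : ℕ} (x y : Sph d) :
    dist x y ^ 2 = 2 - 2 * ⟪(x : Euc (d+1)), (y : Euc (d+1))⟫ := by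
  rw [Subtype.dist_eq, dist_eq_norm, norm_sub_sq_real, sph_norm, sph_norm]; ring

/-- the tangent hyperplane -/
abbrev tHyp {d : ℕ} (ζ : Sph d) : Submodule ℝ (Euc (d+1)) := (Submodule.span ℝ {(ζ : Euc (d+1))})ᗮ

lemma tHyp_finrank {d : ℕ} (ζ : Sph d) : Module.finrank ℝ (tHyp ζ) = d := by
  haveI : Fact (Module.finrank ℝ (Euc (d+1)) = d + 1) := ⟨by simp⟩
  apply Submodule.finrank_orthogonal_span_singleton
  intro h
  have := sph_norm ζ
  rw [h] at this; simp at this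

instance tHyp_haar {d : ℕ} (ζ : Sph d) :
    (Measure.hausdorffMeasure (d : ℝ) : Measure (tHyp ζ)).IsAddHaarMeasure := by
  have := isAddHaarMeasure_hausdorffMeasure (E := tHyp ζ)
  rwa [tHyp_finrank] at this

lemma mem_tHyp {d : ℕ} (ζ : Sph d) (v : Euc (d+1)) : v ∈ tHyp ζ ↔ ⟪(ζ : Euc (d+1)), v⟫ = 0 :=
  Submodule.mem_orthogonal_singleton_iff_inner_right

/-- projection to the tangent hyperplane -/
def tP {d : ℕ} (ζ : Sph d) (v : Euc (d+1)) : tHyp ζ :=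
  ⟨v - ⟪(ζ : Euc (d+1)), v⟫ • (ζ : Euc (d+1)), by
    rw [mem_tHyp, inner_sub_right, inner_smul_right, sph_inner_self]; ring⟩

lemma tP_dist_sq {d : ℕ} (ζ : Sph d) (v w : Euc (d+1)) :
    dist (tP ζ v) (tP ζ w) ^ 2 = dist v w ^ 2 - ⟪(ζ : Euc (d+1)), v - w⟫ ^ 2 := by
  have h : ((tP ζ v : tHyp ζ) : Euc (d+1)) - (tP ζ w : tHyp ζ)
      = (v - w) - ⟪(ζ : Euc (d+1)), v - w⟫ • (ζ : Euc (d+1)) := by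
    simp only [tP, inner_sub_right, sub_smul]; abel
  rw [Subtype.dist_eq, dist_eq_norm, h, norm_sub_sq_real, inner_smul_right, norm_smul, sph_norm,
    dist_eq_norm, real_inner_comm]
  simp only [Real.norm_eq_abs, mul_one, sq_abs]; ring

lemma tP_lip {d : ℕ} (ζ : Sph d) : LipschitzWith 1 (tP ζ) := by
  apply LipschitzWith.of_dist_le_mul
  intro v w
  have := tP_dist_sq ζ v w
  simp only [NNReal.coe_one, one_mul]
  apply le_of_sq_le_sq _ dist_nonneg
  nlinarith [sq_nonneg ⟪(ζ : Euc (d+1)), v - w⟫]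

lemma sph_finite_local {d : ℕ} (ζ : Sph d) : sphMeasure d (ball ζ (1/2)) < ∞ := by
  rw [sph_apply]
  set S : Set (Euc (d+1)) := Subtype.val '' (ball ζ (1/2)) with hS
  have key : ∀ x ∈ S, ∀ y ∈ S, dist x y ≤ 2 * dist (tP ζ x) (tP ζ y) := by
    rintro _ ⟨x, hx, rfl⟩ _ ⟨y, hy, rfl⟩
    have h1 := tP_dist_sq ζ x y
    rw [mem_ball, ] at hx hy
    have e : ⟪(ζ : Euc (d+1)), (x : Euc (d+1)) - y⟫ = (dist y ζ ^ 2 - dist x ζ ^ 2) / 2 := by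
      rw [sph_dist_sq, sph_dist_sq, inner_sub_right, real_inner_comm, real_inner_comm (y : Euc (d+1))]; ring
    have h2 : |dist y ζ - dist x ζ| ≤ dist (x : Euc (d+1)) y := by
      rw [← Subtype.dist_eq, dist_comm x y]; exact abs_dist_sub_le y x ζ
    have h3 : ⟪(ζ : Euc (d+1)), (x : Euc (d+1)) - y⟫ ^ 2 ≤ (dist (x : Euc (d+1)) y) ^ 2 / 4 := by
      have e2 : ⟪(ζ : Euc (d+1)), (x : Euc (d+1)) - y⟫ =
        (dist y ζ - dist x ζ) * ((dist y ζ + dist x ζ) / 2) := by rw [e]; ring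
      rw [e2, mul_pow]
      have h4 := sq_le_sq' (by linarith [neg_abs_le (dist y ζ - dist x ζ)]) ((le_abs_self _).trans h2)
      have h5 : ((dist y ζ + dist x ζ) / 2) ^ 2 ≤ 1 / 4 := by
        nlinarith [dist_nonneg (x := y) (y := ζ), dist_nonneg (x := x) (y := ζ)]
      nlinarith [sq_nonneg (dist y ζ - dist x ζ)]
    apply le_of_sq_le_sq _ (by positivity)
    rw [mul_pow, h1]
    nlinarith [sq_nonneg (dist (x : Euc (d+1)) y)]
  have inj : Set.InjOn (tP ζ) S := by
    intro x hx y hy h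
    have := key x hx y hy
    rw [h, dist_self, mul_zero] at this
    exact dist_le_zero.1 this
  have lip : LipschitzOnWith 2 (Function.invFunOn (tP ζ) S) (tP ζ '' S) := by
    apply LipschitzOnWith.of_dist_le_mul
    rintro _ ⟨x, hx, rfl⟩ _ ⟨y, hy, rfl⟩
    rw [inj.leftInvOn_invFunOn hx, inj.leftInvOn_invFunOn hy]
    exact key x hx y hy
  have him : Function.invFunOn (tP ζ) S '' (tP ζ '' S) = S := inj.leftInvOn_invFunOn.image_image
  have := lip.hausdorffMeasure_image_le (d := (d : ℝ)) (Nat.cast_nonneg d)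
  rw [him] at this
  refine this.trans_lt (ENNReal.mul_lt_top (by simp) ?_)
  have hb : tP ζ '' S ⊆ closedBall (tP ζ ζ) (1/2) := by
    rintro _ ⟨_, ⟨x, hx, rfl⟩, rfl⟩
    rw [mem_closedBall]
    refine ((tP_lip ζ).dist_le_mul _ _).trans ?_
    simp only [NNReal.coe_one, one_mul]
    exact (le_of_lt (mem_ball.1 hx))
  exact (measure_mono hb).trans_lt measure_closedBall_lt_top

instance sph_finite {d : ℕ} : IsFiniteMeasure (sphMeasure d) := by
  constructor
  apply isCompact_univ.measure_lt_top_of_nhdsWithin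
  intro x _
  refine ⟨ball x (1/2), ?_, sph_finite_local x⟩
  exact mem_nhdsWithin_of_mem_nhds (ball_mem_nhds x (by norm_num))

lemma tP_norm_sq {d : ℕ} (ζ : Sph d) (v : Euc (d+1)) :
    ‖tP ζ v‖ ^ 2 = ‖v‖ ^ 2 - ⟪(ζ : Euc (d+1)), v⟫ ^ 2 := by
  have h0 : tP ζ 0 = 0 := by ext; simp [tP]
  have := tP_dist_sq ζ v 0
  rwa [h0, dist_zero_right, dist_zero_right, sub_zero] at this

lemma ball_subset_tP {d : ℕ} (ζ : Sph d) (ρ : ℝ) (h0 : 0 < ρ) (h1 : ρ ≤ 1) :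
    ball (0 : tHyp ζ) (ρ * (1/2)) ⊆ tP ζ '' (Subtype.val '' (ball ζ ρ)) := by
  intro v hv
  rw [mem_ball_zero_iff] at hv
  have hvζ : ⟪(ζ : Euc (d+1)), (v : Euc (d+1))⟫ = 0 := (mem_tHyp ζ _).1 v.2
  have hn : ‖(v : Euc (d+1))‖ = ‖v‖ := rfl
  have hv0 := norm_nonneg v
  have hle : 0 ≤ 1 - ‖v‖ ^ 2 := by nlinarith
  set t := √(1 - ‖v‖ ^ 2) with ht
  have ht2 : t ^ 2 = 1 - ‖v‖ ^ 2 := Real.sq_sqrt hle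
  have ht0 : 0 ≤ t := Real.sqrt_nonneg _
  have ht1 : 1 - ‖v‖ ^ 2 ≤ t := by
    apply Real.le_sqrt_of_sq_le; nlinarith [sq_nonneg ‖v‖]
  have hx : ‖(v : Euc (d+1)) + t • (ζ : Euc (d+1))‖ = 1 := by
    have : ‖(v : Euc (d+1)) + t • (ζ : Euc (d+1))‖ ^ 2 = 1 := by
      rw [norm_add_sq_real, inner_smul_right, real_inner_comm, hvζ, norm_smul, sph_norm, hn]
      simp [ht2]
    nlinarith [norm_nonneg ((v : Euc (d+1)) + t • (ζ : Euc (d+1)))]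
  let η : Sph d := ⟨(v : Euc (d+1)) + t • (ζ : Euc (d+1)), mem_sphere_zero_iff_norm.2 hx⟩
  have hi : ⟪(ζ : Euc (d+1)), (η : Euc (d+1))⟫ = t := by
    simp only [η, inner_add_right, inner_smul_right, hvζ, sph_inner_self]; ring
  refine ⟨η, ⟨η, ?_, rfl⟩, ?_⟩
  · rw [mem_ball]
    have h2 := sph_dist_sq η ζ
    rw [real_inner_comm, hi] at h2
    apply lt_of_pow_lt_pow_left₀ 2 h0.le
    rw [h2]; nlinarith
  · ext1
    simp only [tP, hi]
    simp [η]

lemma sph_lower {d : ℕ} (hd : 1 ≤ d) : ∃ c : ℝ, 0 < c ∧ ∀ (ζ : Sph d) (ρ : ℝ), 0 < ρ → ρ ≤ 1 →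
    c * ρ ^ d ≤ (sphMeasure d).real (ball ζ ρ) := by
  have hE : (Measure.hausdorffMeasure (d : ℝ) : Measure (Euc d)).IsAddHaarMeasure := by
    have := isAddHaarMeasure_hausdorffMeasure (E := Euc d)
    rwa [finrank_euclideanSpace_fin] at this
  have : Nonempty (Fin d) := ⟨⟨0, hd⟩⟩
  refine ⟨(Measure.hausdorffMeasure (d : ℝ) : Measure (Euc d)).real (ball 0 (1/2)), ?_, ?_⟩
  · rw [Measure.real, ENNReal.toReal_pos_iff]
    exact ⟨measure_ball_pos _ _ (by norm_num), measure_ball_lt_top⟩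
  · intro ζ ρ h0 h1
    let L : tHyp ζ ≃ₗᵢ[ℝ] Euc d :=
      ((stdOrthonormalBasis ℝ (tHyp ζ)).reindex (finCongr (tHyp_finrank ζ))).repr
    have e1 : Measure.hausdorffMeasure (d : ℝ) (ball (0 : tHyp ζ) (ρ * (1/2))) =
        Measure.hausdorffMeasure (d : ℝ) (ball (0 : Euc d) (ρ * (1/2))) := by
      rw [← L.isometry.hausdorffMeasure_image (Or.inl (Nat.cast_nonneg d)),
        LinearIsometryEquiv.image_ball, map_zero]
    have e2 := Measure.addHaar_ball_mul (Measure.hausdorffMeasure (d : ℝ) : Measure (Euc d))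
      0 h0.le (1/2)
    rw [finrank_euclideanSpace_fin] at e2
    have h3 : Measure.hausdorffMeasure (d : ℝ) (ball (0 : tHyp ζ) (ρ * (1/2))) ≤
        sphMeasure d (ball ζ ρ) := by
      rw [sph_apply]
      refine (measure_mono (ball_subset_tP ζ ρ h0 h1)).trans ?_
      have := (tP_lip ζ).hausdorffMeasure_image_le (d := (d : ℝ)) (Nat.cast_nonneg d)
        (Subtype.val '' (ball ζ ρ))
      simpa using this
    rw [e1, e2] at h3
    have h4 := ENNReal.toReal_mono (measure_ne_top _ _) h3
    rw [ENNReal.toReal_mul, ENNReal.toReal_ofReal (by positivity)] at h4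
    rw [mul_comm]; exact h4

lemma sph_level_null {d : ℕ} (hd : 1 ≤ d) (ζ : Sph d) (c : ℝ) :
    sphMeasure d {η | ⟪(ζ : Euc (d+1)), (η : Euc (d+1))⟫ = c} = 0 := by
  rw [sph_apply]
  haveI : Nontrivial (tHyp ζ) := by
    apply Module.nontrivial_of_finrank_pos (R := ℝ); rw [tHyp_finrank]; omega
  set s := sphere (0 : tHyp ζ) (√(1 - c^2))
  have hsub : (Subtype.val '' {η : Sph d | ⟪(ζ : Euc (d+1)), (η : Euc (d+1))⟫ = c}) ⊆
      (fun v : tHyp ζ => c • (ζ : Euc (d+1)) + (v : Euc (d+1))) '' s := by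
    rintro _ ⟨η, hη, rfl⟩
    have hη' : ⟪(ζ : Euc (d+1)), (η : Euc (d+1))⟫ = c := hη
    refine ⟨tP ζ η, ?_, ?_⟩
    · rw [mem_sphere_zero_iff_norm, Submodule.coe_norm]
      have h2 := tP_norm_sq ζ (η : Euc (d+1))
      rw [sph_norm, hη', one_pow] at h2
      rw [← h2, Real.sqrt_sq (norm_nonneg _)]; rfl
    · simp [tP, hη']
  have hiso : Isometry (fun v : tHyp ζ => c • (ζ : Euc (d+1)) + (v : Euc (d+1))) := by
    apply Isometry.of_dist_eq; intro a b; simp [Subtype.dist_eq]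
  refine measure_mono_null hsub ?_
  rw [hiso.hausdorffMeasure_image (Or.inl (Nat.cast_nonneg d))]
  exact Measure.addHaar_sphere _ _ _

/-- height -/
def hgt {d : ℕ} (η : Sph d) : ℝ := ⟪(npole d : Euc (d+1)), (η : Euc (d+1))⟫

lemma hgt_cont {d : ℕ} : Continuous (hgt (d := d)) := by unfold hgt; fun_prop

lemma hgt_abs {d : ℕ} (η : Sph d) : |hgt η| ≤ 1 := by
  have := abs_real_inner_le_norm (npole d : Euc (d+1)) (η : Euc (d+1))
  rwa [sph_norm, sph_norm, one_mul] at this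

lemma hgt_sq {d : ℕ} (η : Sph d) : hgt η ^ 2 ≤ 1 := by
  have := hgt_abs η
  rw [← sq_abs]; nlinarith [abs_nonneg (hgt η)]

lemma hgt_lip {d : ℕ} (x y : Sph d) : |hgt x - hgt y| ≤ dist x y := by
  have := abs_real_inner_le_norm (npole d : Euc (d+1)) ((x : Euc (d+1)) - y)
  rwa [sph_norm, one_mul, inner_sub_right, ← dist_eq_norm] at this

/-- the scalar weak identity -/
def WI {d : ℕ} (u G : Sph d → ℝ) : Prop :=
  Integrable u (sphMeasure d) ∧ Integrable G (sphMeasure d) ∧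
  ∀ ψ : ℝ → ℝ, ContDiff ℝ (⊤ : ℕ∞) ψ →
    ∫ η, ψ (hgt η) * G η ∂(sphMeasure d)
      = - ∫ η, u η * (deriv ψ (hgt η) * (1 - hgt η ^ 2)) ∂(sphMeasure d)
        + (d : ℝ) * ∫ η, u η * (ψ (hgt η) * hgt η) ∂(sphMeasure d)

lemma int_mul {d : ℕ} {u : Sph d → ℝ} (hu : Integrable u (sphMeasure d)) {q : Sph d → ℝ}
    (hq : Continuous q) : Integrable (fun η => u η * q η) (sphMeasure d) := by
  obtain ⟨C, hC⟩ := isCompact_univ.exists_bound_of_continuousOn hq.continuousOn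
  exact hu.mul_bdd (c := C) hq.aestronglyMeasurable (ae_of_all _ fun x => hC x (Set.mem_univ x))

lemma WI_sub {d : ℕ} {u G u' G' : Sph d → ℝ} (h : WI u G) (h' : WI u' G') :
    WI (fun η => u η - u' η) (fun η => G η - G' η) := by
  obtain ⟨h1, h2, h3⟩ := h
  obtain ⟨h1', h2', h3'⟩ := h'
  refine ⟨h1.sub h1', h2.sub h2', fun ψ hψ => ?_⟩
  have a := h3 ψ hψ
  have b := h3' ψ hψ
  have c1 : Continuous (fun η : Sph d => ψ (hgt η)) := hψ.continuous.comp hgt_cont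
  have c2 : Continuous (fun η : Sph d => deriv ψ (hgt η) * (1 - hgt η ^ 2)) :=
    ((hψ.continuous_deriv (by simp)).comp hgt_cont).mul (continuous_const.sub (hgt_cont.pow 2))
  have c3 : Continuous (fun η : Sph d => ψ (hgt η) * hgt η) := c1.mul hgt_cont
  have e1 := integral_sub (int_mul h2 c1) (int_mul h2' c1)
  have e2 := integral_sub (int_mul h1 c2) (int_mul h1' c2)
  have e3 := integral_sub (int_mul h1 c3) (int_mul h1' c3)
  simp only [← sub_mul] at e1 e2 e3
  simp only [mul_comm (ψ _) (G _), mul_comm (ψ _) (G' _)] at a b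
  simp only [mul_comm (ψ _) (G _ - G' _)]
  rw [e1, e2, e3, a, b]; ring

lemma WI_of {d : ℕ} {u : Sph d → ℝ} {g : Sph d → Euc (d+1)} (h : MemW11 u g) :
    WI u (fun η => ⟪(npole d : Euc (d+1)), g η⟫) := by
  obtain ⟨h1, h2, -, h3⟩ := h
  refine ⟨h1, h2.const_inner _, fun ψ hψ => ?_⟩
  set e : Euc (d+1) := (npole d).1 with he
  let φ : Euc (d+1) → ℝ := fun x => ψ ⟪e, x⟫
  have hφ : ContDiff ℝ (⊤ : ℕ∞) φ := hψ.comp (contDiff_const.inner ℝ contDiff_id)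
  have hgrad : ∀ x, gradient φ x = deriv ψ ⟪e, x⟫ • e := by
    intro x
    apply HasGradientAt.gradient
    rw [hasGradientAt_iff_hasFDerivAt]
    have a1 : HasDerivAt ψ (deriv ψ ⟪e, x⟫) ⟪e, x⟫ :=
      (hψ.differentiable (by simp)).differentiableAt.hasDerivAt
    have a2 : HasFDerivAt (fun x : Euc (d+1) => ⟪e, x⟫) (innerSL ℝ e) x :=
      (innerSL ℝ e).hasFDerivAt
    have a3 := a1.comp_hasFDerivAt x a2
    have a4 : (InnerProductSpace.toDual ℝ (Euc (d + 1))) (deriv ψ ⟪e, x⟫ • e)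
        = deriv ψ ⟪e, x⟫ • (innerSL ℝ) e := by
      ext y; simp [inner_smul_left]
    rw [a4]; exact a3
  have key := congrArg (fun v => ⟪e, v⟫) (h3 φ hφ)
  have c1 : Continuous (fun η : Sph d => ψ (hgt η)) := hψ.continuous.comp hgt_cont
  have c2 : Continuous (fun η : Sph d => deriv ψ (hgt η)) :=
    ((hψ.continuous_deriv (by simp)).comp hgt_cont)
  have smulint : ∀ q : Sph d → Euc (d+1), Continuous q →
      Integrable (fun η => u η • q η) (sphMeasure d) := by
    intro q hq
    obtain ⟨C, hC⟩ := isCompact_univ.exists_bound_of_continuousOn hq.continuousOn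
    exact h1.smul_bdd C hq.aestronglyMeasurable (ae_of_all _ fun x => hC x (Set.mem_univ x))
  have i1 : Integrable (fun η : Sph d => φ η • g η) (sphMeasure d) := by
    obtain ⟨C, hC⟩ := isCompact_univ.exists_bound_of_continuousOn c1.continuousOn
    exact h2.bdd_smul C c1.aestronglyMeasurable (ae_of_all _ fun x => hC x (Set.mem_univ x))
  have i2 : Integrable (fun η : Sph d => u η • tangProj η (gradient φ η)) (sphMeasure d) := by
    apply smulint
    simp only [hgrad, tangProj]
    have : Continuous (fun η : Sph d => deriv ψ ⟪e, (η : Euc (d+1))⟫) := c2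
    fun_prop
  have i3 : Integrable (fun η : Sph d => (u η * φ η) • (η : Euc (d+1))) (sphMeasure d) := by
    have := smulint (fun η => φ η • (η : Euc (d+1))) (by
      have : Continuous (fun η : Sph d => φ η) := c1
      fun_prop)
    refine this.congr (ae_of_all _ fun x => ?_)
    simp [smul_smul]
  simp only [inner_add_right, inner_neg_right, inner_smul_right] at key
  rw [← integral_inner i1, ← integral_inner i2, ← integral_inner i3] at key
  have hee : ⟪e, e⟫ = 1 := sph_inner_self _
  simp only [inner_smul_right, hgrad, tangProj, inner_sub_right, inner_smul_left, hee] at key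
  have k1 : ∫ η, u η * (deriv ψ (hgt η) * (1 - hgt η ^ 2)) ∂(sphMeasure d) =
      ∫ x : Sph d, u x * (deriv ψ ⟪e, (x : Euc (d+1))⟫ * 1 -
        (starRingEnd ℝ) (deriv ψ ⟪e, (x : Euc (d+1))⟫) * ⟪e, (x : Euc (d+1))⟫ * ⟪e, (x : Euc (d+1))⟫)
        ∂(sphMeasure d) := by
    apply integral_congr_ae; refine ae_of_all _ fun x => ?_
    simp [hgt, he]; left; ring
  have k2 : ∫ η, u η * (ψ (hgt η) * hgt η) ∂(sphMeasure d) =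
      ∫ x : Sph d, u x * φ x * ⟪e, (x : Euc (d+1))⟫ ∂(sphMeasure d) := by
    apply integral_congr_ae; refine ae_of_all _ fun x => ?_
    simp [hgt, he, φ]; ring
  rw [k1, k2]; exact key

lemma urysohn_smooth {s t : Set ℝ} (hs : IsClosed s) (ht : IsClosed t) (hd : Disjoint s t) :
    ∃ p : ℝ → ℝ, ContDiff ℝ (⊤ : ℕ∞) p ∧ (∀ x ∈ s, p x = 0) ∧ (∀ x ∈ t, p x = 1) ∧
      ∀ x, 0 ≤ p x ∧ p x ≤ 1 := by
  obtain ⟨f, h0, h1, h2⟩ := exists_contMDiffMap_zero_one_of_isClosed (n := (⊤ : ℕ∞))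
    (modelWithCornersSelf ℝ ℝ) hs ht hd
  exact ⟨f, f.contMDiff.contDiff, fun x hx => h0 hx, fun x hx => h1 hx, fun x => h2 x⟩

lemma antideriv {a b : ℝ} (hab : a ≤ b) {p : ℝ → ℝ} (hp : ContDiff ℝ (⊤ : ℕ∞) p)
    (h0 : ∀ x, x ∉ Set.Ioo a b → p x = 0) (h1 : ∀ x, |p x| ≤ 1) :
    ∃ ψ : ℝ → ℝ, ContDiff ℝ (⊤ : ℕ∞) ψ ∧ deriv ψ = p ∧ ∀ x, |ψ x| ≤ b - a := by
  have hder : ∀ x, HasDerivAt (fun t => ∫ s in a..t, p s) (p x) x := fun x =>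
    hp.continuous.integral_hasStrictDerivAt a x |>.hasDerivAt
  have hd : deriv (fun t => ∫ s in a..t, p s) = p := funext fun x => (hder x).deriv
  refine ⟨fun t => ∫ s in a..t, p s, ?_, hd, fun x => ?_⟩
  · rw [contDiff_infty_iff_deriv]
    exact ⟨fun x => (hder x).differentiableAt, by rw [hd]; exact hp⟩
  · have hi : Integrable p := by
      apply hp.continuous.integrable_of_hasCompactSupport
      apply HasCompactSupport.of_support_subset_isCompact (isCompact_Icc (a := a) (b := b))
      intro x hx
      by_contra h
      exact hx (h0 x fun h' => h (Set.Ioo_subset_Icc_self h'))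
    calc |∫ s in a..x, p s| ≤ ∫ s in Set.uIoc a x, ‖p s‖ :=
          (Real.norm_eq_abs _).symm.le.trans intervalIntegral.norm_integral_le_integral_norm_uIoc
      _ ≤ ∫ s, ‖p s‖ := setIntegral_le_integral hi.norm (ae_of_all _ fun _ => norm_nonneg _)
      _ ≤ ∫ s, (Set.Ioo a b).indicator (fun _ => (1:ℝ)) s := by
          apply integral_mono hi.norm
          · exact (integrable_indicator_iff measurableSet_Ioo).2 (by simp)
          · intro s
            by_cases hs : s ∈ Set.Ioo a b
            · simpa [hs] using h1 s
            · simp [hs, h0 s hs]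
      _ = b - a := by
          rw [integral_indicator measurableSet_Ioo]; simp [hab]

lemma inner_approx {d : ℕ} {u : Sph d → ℝ} (hu : Integrable u (sphMeasure d)) {A : Set (Sph d)}
    (hA : NullMeasurableSet A (sphMeasure d)) {ε : ℝ} (hε : 0 < ε) :
    ∃ K E : Set (Sph d), IsCompact K ∧ K ⊆ A ∧ MeasurableSet E ∧
      (∀ᵐ η ∂(sphMeasure d), η ∈ A → η ∈ K ∨ η ∈ E) ∧
      ∫ η in E, |u η| ∂(sphMeasure d) ≤ ε := by
  obtain ⟨A', hA', hmA', hae⟩ := hA.exists_measurable_subset_ae_eq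
  obtain ⟨δ, hδ, hδ'⟩ := exists_pos_setLIntegral_lt_of_measure_lt (μ := sphMeasure d)
    (f := fun η => ‖u η‖ₑ) hu.2.ne (ε := ENNReal.ofReal ε) (by simpa using hε)
  obtain ⟨K, hKA, hK, hKm⟩ := hmA'.exists_isCompact_sdiff_lt (measure_ne_top (sphMeasure d) _) hδ.ne'
  refine ⟨K, A' \ K, hK, hKA.trans hA', hmA'.diff hK.measurableSet, ?_, ?_⟩
  · filter_upwards [hae] with η hη hηA
    have : η ∈ A' := by
      exact (eq_iff_iff.1 hη).2 hηA
    by_cases h : η ∈ K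
    · exact Or.inl h
    · exact Or.inr ⟨this, h⟩
  · have := hδ' _ hKm
    have e := integral_norm_eq_lintegral_enorm (μ := (sphMeasure d).restrict (A' \ K))
      (f := u) hu.1.restrict
    simp only [Real.norm_eq_abs] at e
    rw [e]
    exact ENNReal.toReal_le_of_le_ofReal hε.le this.le

lemma strip {d : ℕ} {u G : Sph d → ℝ} (hW : WI u G)
    (hpol : ∀ x y : Sph d, hgt x = hgt y → u x = u y) {a b : ℝ} (hab : a ≤ b) :
    ∫ η in {η | hgt η ∈ Set.Ioo a b}, |u η| * (1 - hgt η ^ 2) ∂(sphMeasure d) ≤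
      (b - a) * (∫ η, |G η| ∂(sphMeasure d) + d * ∫ η, |u η| ∂(sphMeasure d)) := by
  obtain ⟨hu, hG, hI⟩ := hW
  apply le_of_forall_pos_le_add
  intro ε hε
  have hTm : MeasurableSet {η : Sph d | hgt η ∈ Set.Ioo a b} := hgt_cont.measurable measurableSet_Ioo
  set T := {η : Sph d | hgt η ∈ Set.Ioo a b} with hT
  have hAp : NullMeasurableSet ({η | 0 < u η} ∩ T) (sphMeasure d) :=
    (nullMeasurableSet_lt aemeasurable_const hu.aemeasurable).inter hTm.nullMeasurableSet
  have hAm : NullMeasurableSet ({η | u η < 0} ∩ T) (sphMeasure d) :=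
    (nullMeasurableSet_lt hu.aemeasurable aemeasurable_const).inter hTm.nullMeasurableSet
  obtain ⟨Kp, Ep, hKp, hKpA, hEp, haep, hip⟩ := inner_approx hu hAp (ε := ε / 4) (by linarith)
  obtain ⟨Km, Em, hKm, hKmA, hEm, haem, him⟩ := inner_approx hu hAm (ε := ε / 4) (by linarith)
  have cKp := (hKp.image hgt_cont).isClosed
  have cKm := (hKm.image hgt_cont).isClosed
  have cI : IsClosed (Set.Ioo a b)ᶜ := isOpen_Ioo.isClosed_compl
  have hdis : Disjoint (hgt '' Kp) (hgt '' Km) := by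
    rw [Set.disjoint_left]
    rintro _ ⟨x, hx, rfl⟩ ⟨y, hy, hxy⟩
    have h1 : 0 < u x := (hKpA hx).1
    have h2 : u y < 0 := (hKmA hy).1
    rw [hpol y x hxy] at h2
    linarith
  have hdp : Disjoint (Set.Ioo a b)ᶜ (hgt '' Kp) := by
    rw [Set.disjoint_right]
    rintro _ ⟨x, hx, rfl⟩ h
    exact h (hKpA hx).2
  have hdm : Disjoint (Set.Ioo a b)ᶜ (hgt '' Km) := by
    rw [Set.disjoint_right]
    rintro _ ⟨x, hx, rfl⟩ h
    exact h (hKmA hx).2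
  obtain ⟨p1, hp1, p1z, p1o, p1b⟩ := urysohn_smooth (cI.union cKm) cKp
    (Set.disjoint_union_left.2 ⟨hdp, hdis.symm⟩)
  obtain ⟨p2, hp2, p2z, p2o, p2b⟩ := urysohn_smooth (cI.union cKp) cKm
    (Set.disjoint_union_left.2 ⟨hdm, hdis⟩)
  obtain ⟨ψ, hψ, hψ', hψb⟩ := antideriv hab (p := fun x => p1 x - p2 x) (hp1.sub hp2)
    (fun x hx => by simp [p1z x (Or.inl hx), p2z x (Or.inl hx)])
    (fun x => by rw [abs_le]; constructor <;> linarith [p1b x, p2b x])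
  have key := hI ψ hψ
  rw [hψ'] at key
  have c1 : Continuous (fun η : Sph d => (p1 (hgt η) - p2 (hgt η)) * (1 - hgt η ^ 2)) := by
    have := hp1.continuous
    have := hp2.continuous
    have := hgt_cont (d := d)
    fun_prop
  have cψ : Continuous (fun η : Sph d => ψ (hgt η)) := hψ.continuous.comp hgt_cont
  have hw : Integrable (fun η => |u η| * (1 - hgt η ^ 2)) (sphMeasure d) :=
    int_mul hu.abs (continuous_const.sub (hgt_cont.pow 2))
  -- lower bound
  have low : ∫ η in T, |u η| * (1 - hgt η ^ 2) ∂(sphMeasure d)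
      - 2 * ∫ η in Ep, |u η| ∂(sphMeasure d) - 2 * ∫ η in Em, |u η| ∂(sphMeasure d)
      ≤ ∫ η, u η * ((p1 (hgt η) - p2 (hgt η)) * (1 - hgt η ^ 2)) ∂(sphMeasure d) := by
    rw [← integral_indicator hTm, ← integral_indicator hEp, ← integral_indicator hEm,
      ← integral_const_mul, ← integral_const_mul, ← integral_sub, ← integral_sub]
    · apply integral_mono_ae
      · exact ((hw.indicator hTm).sub ((hu.abs.indicator hEp).const_mul 2)).sub
          ((hu.abs.indicator hEm).const_mul 2)
      · exact int_mul hu c1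
      · filter_upwards [haep, haem] with η h1 h2
        have hs := hgt_sq η
        have hs0 := sq_nonneg (hgt η)
        have ha := abs_nonneg (u η)
        have i1 : 0 ≤ Ep.indicator (fun η => |u η|) η := Set.indicator_nonneg (fun _ _ => abs_nonneg _) _
        have i2 : 0 ≤ Em.indicator (fun η => |u η|) η := Set.indicator_nonneg (fun _ _ => abs_nonneg _) _
        by_cases hη : η ∈ T
        · rw [Set.indicator_of_mem hη]
          have gen : |u η| * (1 - hgt η ^ 2) - 2 * |u η| ≤
              u η * ((p1 (hgt η) - p2 (hgt η)) * (1 - hgt η ^ 2)) := by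
            have b1 : |u η * ((p1 (hgt η) - p2 (hgt η)) * (1 - hgt η ^ 2))| ≤ |u η| * (1 - hgt η ^ 2) := by
              rw [abs_mul, abs_mul, abs_of_nonneg (by linarith : 0 ≤ 1 - hgt η ^ 2)]
              have : |p1 (hgt η) - p2 (hgt η)| ≤ 1 := by
                rw [abs_le]; constructor <;> linarith [p1b (hgt η), p2b (hgt η)]
              apply mul_le_mul_of_nonneg_left _ ha
              nlinarith
            have := (abs_le.1 b1).1
            nlinarith
          rcases lt_trichotomy (u η) 0 with h | h | h
          · rcases h2 ⟨h, hη⟩ with hk | hk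
            · rw [p2o _ ⟨η, hk, rfl⟩, p1z _ (Or.inr ⟨η, hk, rfl⟩), abs_of_neg h]
              linarith
            · rw [Set.indicator_of_mem hk]; linarith
          · rw [h] at gen ⊢; simp at gen ⊢; linarith
          · rcases h1 ⟨h, hη⟩ with hk | hk
            · rw [p1o _ ⟨η, hk, rfl⟩, p2z _ (Or.inr ⟨η, hk, rfl⟩), abs_of_pos h]
              linarith
            · rw [Set.indicator_of_mem hk]; linarith
        · rw [Set.indicator_of_notMem hη, p1z _ (Or.inl hη), p2z _ (Or.inl hη)]
          linarith
    · exact (hw.indicator hTm).sub ((hu.abs.indicator hEp).const_mul 2)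
    · exact (hu.abs.indicator hEm).const_mul 2
    · exact hw.indicator hTm
    · exact (hu.abs.indicator hEp).const_mul 2
  -- upper bound
  have up1 : |∫ η, ψ (hgt η) * G η ∂(sphMeasure d)| ≤ (b - a) * ∫ η, |G η| ∂(sphMeasure d) := by
    rw [← integral_const_mul]
    refine (abs_integral_le_integral_abs).trans (integral_mono_of_nonneg
      (ae_of_all _ fun _ => abs_nonneg _) (hG.abs.const_mul _) (ae_of_all _ fun η => ?_))
    simp only [abs_mul]
    exact mul_le_mul_of_nonneg_right (hψb _) (abs_nonneg _)
  have up2 : |∫ η, u η * (ψ (hgt η) * hgt η) ∂(sphMeasure d)| ≤ (b - a) * ∫ η, |u η| ∂(sphMeasure d) := by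
    rw [← integral_const_mul]
    refine (abs_integral_le_integral_abs).trans (integral_mono_of_nonneg
      (ae_of_all _ fun _ => abs_nonneg _) (hu.abs.const_mul _) (ae_of_all _ fun η => ?_))
    simp only [abs_mul]
    rw [mul_comm]
    apply mul_le_mul_of_nonneg_right _ (abs_nonneg _)
    nlinarith [hψb (hgt η), hgt_abs η, abs_nonneg (hgt η), abs_nonneg (ψ (hgt η))]
  have hd0 : (0:ℝ) ≤ d := Nat.cast_nonneg d
  have up3 := mul_le_mul_of_nonneg_left ((le_abs_self _).trans up2) hd0
  have up4 := (abs_le.1 up1).1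
  nlinarith

lemma dist_eq_geodist {d : ℕ} (x y : Sph d) : dist x y = 2 * Real.sin (geodist x y / 2) := by
  have h0 : 0 ≤ geodist x y := Real.arccos_nonneg _
  have h1 : geodist x y ≤ Real.pi := Real.arccos_le_pi _
  have hs : 0 ≤ Real.sin (geodist x y / 2) :=
    Real.sin_nonneg_of_nonneg_of_le_pi (by linarith) (by linarith)
  have hi := abs_real_inner_le_norm (x : Euc (d+1)) (y : Euc (d+1))
  rw [sph_norm, sph_norm, one_mul, abs_le] at hi
  have hc : Real.cos (geodist x y) = ⟪(x : Euc (d+1)), (y : Euc (d+1))⟫ :=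
    Real.cos_arccos hi.1 hi.2
  have e : dist x y ^ 2 = (2 * Real.sin (geodist x y / 2)) ^ 2 := by
    rw [sph_dist_sq, ← hc]
    have : geodist x y = 2 * (geodist x y / 2) := by ring
    rw [this, Real.cos_two_mul, ← this]
    nlinarith [Real.sin_sq_add_cos_sq (geodist x y / 2)]
  exact (pow_left_inj₀ dist_nonneg (by positivity) two_ne_zero).1 e

lemma geodist_lt_iff {d : ℕ} (x y : Sph d) {r : ℝ} (h0 : 0 ≤ r) (h1 : r ≤ Real.pi) :
    geodist x y < r ↔ dist y x < 2 * Real.sin (r / 2) := by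
  have a0 : 0 ≤ geodist x y := Real.arccos_nonneg _
  have a1 : geodist x y ≤ Real.pi := Real.arccos_le_pi _
  rw [dist_comm, dist_eq_geodist]
  have := Real.strictMonoOn_sin.lt_iff_lt (a := geodist x y / 2) (b := r / 2)
    ⟨by linarith, by linarith⟩ ⟨by linarith, by linarith⟩
  constructor
  · intro h; linarith [this.2 (by linarith)]
  · intro h; linarith [this.1 (by linarith)]

lemma gball_eq {d : ℕ} (x : Sph d) {r : ℝ} (h0 : 0 ≤ r) (h1 : r ≤ Real.pi) :
    gball x r = ball x (2 * Real.sin (r / 2)) := by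
  ext y; exact geodist_lt_iff x y h0 h1

lemma geodist_le {d : ℕ} {x y : Sph d} {r : ℝ} (h1 : r ≤ Real.pi) (h : geodist x y ≤ r) :
    dist x y ≤ 2 * Real.sin (r / 2) := by
  have a0 : 0 ≤ geodist x y := Real.arccos_nonneg _
  rw [dist_eq_geodist]
  have := Real.sin_le_sin_of_le_of_le_pi_div_two (x := geodist x y / 2) (y := r / 2)
    (by linarith) (by linarith) (by linarith)
  linarith

/-- reflection of the sphere exchanging x and y -/
def sphRefl {d : ℕ} (x y : Sph d) : Sph d ≃ᵢ Sph d where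
  toFun η := ⟨((Submodule.span ℝ {(x : Euc (d+1)) - y})ᗮ).reflection η, by
    rw [mem_sphere_zero_iff_norm, LinearIsometryEquiv.norm_map, sph_norm]⟩
  invFun η := ⟨((Submodule.span ℝ {(x : Euc (d+1)) - y})ᗮ).reflection η, by
    rw [mem_sphere_zero_iff_norm, LinearIsometryEquiv.norm_map, sph_norm]⟩
  left_inv η := by ext1; simp
  right_inv η := by ext1; simp
  isometry_toFun := by
    apply Isometry.of_dist_eq; intro a b
    simp only [Subtype.dist_eq]
    exact LinearIsometryEquiv.dist_map _ _ _

lemma refl_integral {d : ℕ} {u : Sph d → ℝ} (hpol : ∀ x y : Sph d, hgt x = hgt y → u x = u y)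
    {x y : Sph d} (hxy : hgt x = hgt y) (ρ : ℝ) :
    ∫ η in ball x ρ, |u η| ∂(sphMeasure d) = ∫ η in ball y ρ, |u η| ∂(sphMeasure d) := by
  have hR : sphRefl x y x = y := by
    ext1; exact Submodule.reflection_sub (by rw [sph_norm, sph_norm])
  have hh : ∀ η, hgt (sphRefl x y η) = hgt η := by
    intro η
    have he : ((Submodule.span ℝ {(x : Euc (d+1)) - y})ᗮ).reflection (npole d : Euc (d+1)) = npole d := by
      apply Submodule.reflection_mem_subspace_eq_self
      rw [Submodule.mem_orthogonal_singleton_iff_inner_right, real_inner_comm, inner_sub_right]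
      exact sub_eq_zero.2 hxy
    unfold hgt
    conv_lhs => rw [← he]
    exact LinearIsometryEquiv.inner_map_map _ _ _
  have mp : MeasurePreserving (sphRefl x y) (sphMeasure d) (sphMeasure d) := by
    rw [sph_eq]; exact (sphRefl x y).measurePreserving_hausdorffMeasure _
  have := mp.setIntegral_preimage_emb (sphRefl x y).toHomeomorph.measurableEmbedding
    (fun η => |u η|) (ball y ρ)
  rw [IsometryEquiv.preimage_ball] at this
  have h2 : (sphRefl x y).symm y = x := (sphRefl x y).toEquiv.symm_apply_eq.2 hR.symm
  rw [h2] at this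
  rw [← this]
  simp only [hpol _ _ (hh _)]

lemma hgt_coord {d : ℕ} (η : Sph d) : hgt η = (η : Euc (d+1)) 0 := by
  unfold hgt npole
  rw [EuclideanSpace.inner_single_left]; simp

lemma packing {m : ℕ} (ζ : Sph (m+1)) {s ρ : ℝ} (hs : 0 < s) (hs2 : s ^ 2 ≤ 1 - hgt ζ ^ 2)
    (hρ : 0 < ρ) (M : ℕ) (hM : 2 * ρ * M * (m + 1) ≤ s) :
    ∃ P : (Fin m → Fin M) → Sph (m+1), (∀ k, hgt (P k) = hgt ζ) ∧
      ∀ k l, k ≠ l → 2 * ρ ≤ dist (P k) (P l) := by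
  have hsum : ∀ k : Fin m → Fin M, ∑ i, (2 * ρ * (k i : ℝ)) ^ 2 ≤ 1 - hgt ζ ^ 2 := by
    intro k
    refine le_trans ?_ hs2
    have h1 : ∀ i, (2 * ρ * (k i : ℝ)) ^ 2 ≤ (2 * ρ * M) ^ 2 := by
      intro i
      have : (k i : ℝ) ≤ M := by exact_mod_cast (k i).2.le
      gcongr
    calc _ ≤ ∑ i : Fin m, (2 * ρ * (M:ℝ)) ^ 2 := Finset.sum_le_sum fun i _ => h1 i
      _ = m * (2 * ρ * M) ^ 2 := by simp
      _ ≤ (2 * ρ * M * (m + 1)) ^ 2 := by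
        rw [mul_pow _ ((m:ℝ) + 1), mul_comm]
        have : (0:ℝ) ≤ m := Nat.cast_nonneg m
        apply mul_le_mul_of_nonneg_left _ (sq_nonneg _)
        nlinarith
      _ ≤ s ^ 2 := by gcongr
  let V : (Fin m → Fin M) → Euc (m+1+1) := fun k => WithLp.toLp 2
    (Fin.cons (hgt ζ) (Fin.snoc (fun i => 2 * ρ * (k i : ℝ))
      (√(1 - hgt ζ ^ 2 - ∑ i, (2 * ρ * (k i : ℝ)) ^ 2)) : Fin (m+1) → ℝ) : Fin (m+1+1) → ℝ)
  have hV : ∀ k, ‖V k‖ = 1 := by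
    intro k
    have : ‖V k‖ ^ 2 = 1 := by
      rw [EuclideanSpace.norm_sq_eq, Fin.sum_univ_succ, Fin.sum_univ_castSucc]
      simp only [V, Fin.cons_zero, Fin.cons_succ, Fin.snoc_castSucc, Fin.snoc_last, Real.norm_eq_abs,
        sq_abs]
      rw [Real.sq_sqrt (by linarith [hsum k])]; ring
    nlinarith [norm_nonneg (V k)]
  refine ⟨fun k => ⟨V k, mem_sphere_zero_iff_norm.2 (hV k)⟩, fun k => ?_, fun k l hkl => ?_⟩
  · rw [hgt_coord (⟨V k, mem_sphere_zero_iff_norm.2 (hV k)⟩ : Sph (m+1))]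
    simp [V]
  · obtain ⟨i, hi⟩ := Function.ne_iff.1 hkl
    rw [Subtype.dist_eq, dist_eq_norm]
    refine le_trans ?_ (PiLp.norm_apply_le (V k - V l) (Fin.succ (Fin.castSucc i)))
    simp only [V, PiLp.sub_apply, Fin.cons_succ, Fin.snoc_castSucc, Real.norm_eq_abs]
    rw [← mul_sub, abs_mul, abs_of_pos (by linarith : 0 < 2 * ρ)]
    have : (1:ℝ) ≤ |((k i : ℕ) : ℝ) - ((l i : ℕ) : ℝ)| := by
      have h3 : ((k i : ℕ) : ℤ) - ((l i : ℕ) : ℤ) ≠ 0 := by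
        intro h; apply hi; ext; omega
      exact_mod_cast Int.one_le_abs h3
    nlinarith

lemma pack_bound {m : ℕ} {u : Sph (m+1) → ℝ} (hu : Integrable u (sphMeasure (m+1)))
    (hpol : ∀ x y : Sph (m+1), hgt x = hgt y → u x = u y)
    (ζ : Sph (m+1)) {s ρ : ℝ} (hs : 0 < s) (hs2 : s ^ 2 ≤ 1 - hgt ζ ^ 2)
    (hρ : 0 < ρ) (M : ℕ) (hM : 2 * ρ * M * (m + 1) ≤ s) :
    (M:ℝ) ^ m * ∫ η in ball ζ ρ, |u η| ∂(sphMeasure (m+1)) ≤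
      ∫ η in {η | hgt η ∈ Set.Ioo (hgt ζ - ρ) (hgt ζ + ρ)}, |u η| ∂(sphMeasure (m+1)) := by
  obtain ⟨P, hP, hPd⟩ := packing ζ hs hs2 hρ M hM
  have e1 : ∫ η in ⋃ k, ball (P k) ρ, |u η| ∂(sphMeasure (m+1)) =
      ∑ k, ∫ η in ball (P k) ρ, |u η| ∂(sphMeasure (m+1)) := by
    apply integral_iUnion_fintype
    · intro k; exact isOpen_ball.measurableSet
    · intro k l hkl
      apply ball_disjoint_ball
      linarith [hPd k l hkl]
    · intro k; exact hu.abs.integrableOn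
  have e2 : ∑ k, ∫ η in ball (P k) ρ, |u η| ∂(sphMeasure (m+1)) =
      (M:ℝ) ^ m * ∫ η in ball ζ ρ, |u η| ∂(sphMeasure (m+1)) := by
    rw [Finset.sum_congr rfl (fun k _ => refl_integral hpol (hP k) ρ)]
    simp
  rw [← e2, ← e1]
  apply setIntegral_mono_set hu.abs.integrableOn (ae_of_all _ fun _ => abs_nonneg _)
  apply HasSubset.Subset.eventuallyLE
  intro η hη
  obtain ⟨k, hk⟩ := Set.mem_iUnion.1 hη
  have := (hgt_lip η (P k)).trans_lt (mem_ball.1 hk)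
  rw [hP k, abs_lt] at this
  constructor <;> linarith

lemma key_bound {d : ℕ} (hd : 1 ≤ d) (ξ : Sph d) (hξ : hgt ξ ^ 2 < 1) :
    ∃ C : ℝ, 0 ≤ C ∧ ∀ u G : Sph d → ℝ, WI u G → (∀ x y : Sph d, hgt x = hgt y → u x = u y) →
      ∀ (ζ : Sph d) (ρ : ℝ), 0 < ρ → dist ζ ξ ≤ ρ →
      ⨍ η in ball ζ ρ, |u η| ∂(sphMeasure d) ≤
        C * (∫ η, |G η| ∂(sphMeasure d) + d * ∫ η, |u η| ∂(sphMeasure d)) := by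
  obtain ⟨m, rfl⟩ : ∃ m, d = m + 1 := ⟨d - 1, by omega⟩
  obtain ⟨c, hc, hlow⟩ := sph_lower hd
  set κ := 1 - hgt ξ ^ 2 with hκ
  have hκ0 : 0 < κ := by linarith
  have hκ1 : κ ≤ 1 := by linarith [sq_nonneg (hgt ξ)]
  have hm : (0:ℝ) ≤ m := Nat.cast_nonneg m
  set ρ0 := κ / (8 * (m + 1)) with hρ0
  have hρ0p : 0 < ρ0 := by positivity
  have hρ0e : ρ0 * (8 * (m + 1)) = κ := by rw [hρ0]; field_simp
  have hρ08 : 8 * ρ0 ≤ κ := by nlinarith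
  refine ⟨max (4 / κ / ρ0 ^ m / c) (1 / (c * ρ0 ^ (m+1))), by positivity, ?_⟩
  intro u G hW hpol ζ ρ hρ hζ
  have hu := hW.1
  set W := ∫ η, |G η| ∂(sphMeasure (m+1)) + ((m+1 : ℕ):ℝ) * ∫ η, |u η| ∂(sphMeasure (m+1)) with hWdef
  have hI0 : 0 ≤ ∫ η, |u η| ∂(sphMeasure (m+1)) := integral_nonneg fun _ => abs_nonneg _
  have hG0 : 0 ≤ ∫ η, |G η| ∂(sphMeasure (m+1)) := integral_nonneg fun _ => abs_nonneg _
  have hIW : ∫ η, |u η| ∂(sphMeasure (m+1)) ≤ W := by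
    rw [hWdef]; push_cast; nlinarith
  have hW0 : 0 ≤ W := hI0.trans hIW
  rw [setAverage_eq, smul_eq_mul]
  rcases le_total ρ ρ0 with h | h
  · -- small balls
    have hσ := hlow ζ ρ hρ (by linarith)
    have hlipζ := (hgt_lip ζ ξ).trans hζ
    have hstr : ∀ t : ℝ, |t - hgt ξ| ≤ 2 * ρ → |t| ≤ 1 → κ / 2 ≤ 1 - t ^ 2 := by
      intro t ht ht1
      have h2 := hgt_abs ξ
      have e : t ^ 2 - hgt ξ ^ 2 ≤ |t - hgt ξ| * |t + hgt ξ| := by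
        rw [← abs_mul]; refine le_trans (le_of_eq ?_) (le_abs_self _); ring
      have e2 : |t + hgt ξ| ≤ 2 := (abs_add_le _ _).trans (by linarith)
      nlinarith [abs_nonneg (t - hgt ξ), abs_nonneg (t + hgt ξ)]
    have hs2 : (κ / 2) ^ 2 ≤ 1 - hgt ζ ^ 2 := by
      have := hstr (hgt ζ) (by linarith) (hgt_abs ζ)
      nlinarith
    set x := ρ0 * 2 / ρ with hx
    have hx2 : 2 ≤ x := by rw [hx, le_div_iff₀ hρ]; linarith
    have hxe : x * ρ = ρ0 * 2 := by rw [hx]; field_simp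
    have hMle : (⌊x⌋₊ : ℝ) ≤ x := Nat.floor_le (by linarith)
    have hMge : ρ0 / ρ ≤ (⌊x⌋₊ : ℝ) := by
      have := Nat.lt_floor_add_one x
      have e : ρ0 / ρ = x / 2 := by rw [hx]; ring
      linarith
    have hpk := pack_bound hu hpol ζ (half_pos hκ0) hs2 hρ ⌊x⌋₊ (by
      calc 2 * ρ * (⌊x⌋₊ : ℝ) * (m + 1) ≤ 2 * ρ * x * (m + 1) := by gcongr
        _ = 2 * (x * ρ) * (m + 1) := by ring
        _ = κ / 2 := by rw [hxe, ← hρ0e]; ring)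
    have hst := strip hW hpol (a := hgt ζ - ρ) (b := hgt ζ + ρ) (by linarith)
    have hTm : MeasurableSet {η : Sph (m+1) | hgt η ∈ Set.Ioo (hgt ζ - ρ) (hgt ζ + ρ)} :=
      hgt_cont.measurable measurableSet_Ioo
    have hcmp : κ / 2 * ∫ η in {η | hgt η ∈ Set.Ioo (hgt ζ - ρ) (hgt ζ + ρ)}, |u η| ∂(sphMeasure (m+1))
        ≤ ∫ η in {η | hgt η ∈ Set.Ioo (hgt ζ - ρ) (hgt ζ + ρ)}, |u η| * (1 - hgt η ^ 2)
          ∂(sphMeasure (m+1)) := by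
      rw [← integral_const_mul]
      apply setIntegral_mono_on (hu.abs.integrableOn.const_mul _)
        (int_mul hu.abs (continuous_const.sub (hgt_cont.pow 2))).integrableOn hTm
      intro η hη
      rw [mul_comm]
      apply mul_le_mul_of_nonneg_left _ (abs_nonneg _)
      apply hstr _ _ (hgt_abs η)
      have h1 : |hgt η - hgt ζ| ≤ ρ := by rw [abs_le]; constructor <;> linarith [hη.1, hη.2]
      have := abs_sub_le (hgt η) (hgt ζ) (hgt ξ)
      linarith
    set J := ∫ η in ball ζ ρ, |u η| ∂(sphMeasure (m+1)) with hJ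
    have hJ0 : 0 ≤ J := integral_nonneg fun _ => abs_nonneg _
    have h1 : (ρ0 / ρ) ^ m * J ≤ 4 / κ * ρ * W := by
      have a1 : (ρ0 / ρ) ^ m * J ≤ (⌊x⌋₊ : ℝ) ^ m * J := by gcongr
      have a2 : κ / 2 * ((ρ0 / ρ) ^ m * J) ≤ 2 * ρ * W := by
        refine (mul_le_mul_of_nonneg_left (a1.trans hpk) (half_pos hκ0).le).trans (hcmp.trans (hst.trans ?_))
        apply le_of_eq; rw [hWdef]; ring
      calc (ρ0 / ρ) ^ m * J = 2 / κ * (κ / 2 * ((ρ0 / ρ) ^ m * J)) := by field_simp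
        _ ≤ 2 / κ * (2 * ρ * W) := by gcongr
        _ = _ := by ring
    have h2 : J ≤ 4 / κ / ρ0 ^ m * ρ ^ (m+1) * W := by
      rw [div_pow, div_mul_eq_mul_div, div_le_iff₀ (by positivity)] at h1
      rw [div_mul_eq_mul_div, div_mul_eq_mul_div, le_div_iff₀ (by positivity)]
      calc J * ρ0 ^ m = ρ0 ^ m * J := mul_comm _ _
        _ ≤ _ := h1
        _ = _ := by ring
    calc ((sphMeasure (m+1)).real (ball ζ ρ))⁻¹ * J
        ≤ (c * ρ ^ (m+1))⁻¹ * (4 / κ / ρ0 ^ m * ρ ^ (m+1) * W) := by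
          gcongr
      _ = 4 / κ / ρ0 ^ m / c * W := by field_simp
      _ ≤ _ := by gcongr; exact le_max_left _ _
  · have hσ : c * ρ0 ^ (m+1) ≤ (sphMeasure (m+1)).real (ball ζ ρ) :=
      (hlow ζ ρ0 hρ0p (by linarith)).trans (measureReal_mono (ball_subset_ball h))
    have hJ : ∫ η in ball ζ ρ, |u η| ∂(sphMeasure (m+1)) ≤ W :=
      (setIntegral_le_integral hu.abs (ae_of_all _ fun _ => abs_nonneg _)).trans hIW
    calc _ ≤ (c * ρ0 ^ (m+1))⁻¹ * W := by gcongr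
      _ = 1 / (c * ρ0 ^ (m+1)) * W := by rw [one_div]
      _ ≤ _ := by gcongr; exact le_max_right _ _

lemma geodist_tendsto {d : ℕ} {z : ℕ → Sph d} {ζ : Sph d} (η : Sph d)
    (hz : Tendsto z atTop (𝓝 ζ)) :
    Tendsto (fun n => geodist (z n) η) atTop (𝓝 (geodist ζ η)) := by
  have h0 : Tendsto (fun n => (z n : Euc (d+1))) atTop (𝓝 (ζ : Euc (d+1))) :=
    (continuous_subtype_val.tendsto ζ).comp hz
  have h1 : Tendsto (fun n => ⟪(z n : Euc (d+1)), (η : Euc (d+1))⟫) atTop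
      (𝓝 ⟪(ζ : Euc (d+1)), (η : Euc (d+1))⟫) := h0.inner tendsto_const_nhds
  exact (Real.continuous_arccos.tendsto _).comp h1

lemma gball_meas {d : ℕ} (ζ : Sph d) (r : ℝ) : MeasurableSet (gball ζ r) := by
  have h0 : Continuous (fun η : Sph d => ⟪(ζ : Euc (d+1)), (η : Euc (d+1))⟫) :=
    continuous_const.inner continuous_subtype_val
  have : Continuous (fun η : Sph d => geodist ζ η) := Real.continuous_arccos.comp h0
  exact (isOpen_lt this continuous_const).measurableSet

lemma gsphere_null {d : ℕ} (hd : 1 ≤ d) (ζ : Sph d) (r : ℝ) :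
    ∀ᵐ η ∂(sphMeasure d), geodist ζ η ≠ r := by
  rw [ae_iff]
  refine measure_mono_null ?_ (sph_level_null hd ζ (Real.cos r))
  intro η hη
  have hη' : geodist ζ η = r := by simpa using hη
  have hi := abs_real_inner_le_norm (ζ : Euc (d+1)) (η : Euc (d+1))
  rw [sph_norm, sph_norm, one_mul, abs_le] at hi
  have : Real.cos (geodist ζ η) = ⟪(ζ : Euc (d+1)), (η : Euc (d+1))⟫ :=
    Real.cos_arccos hi.1 hi.2
  rw [hη'] at this
  exact this.symm

lemma ball_int_cont {d : ℕ} (hd : 1 ≤ d) {v : Sph d → ℝ} (hv : Integrable v (sphMeasure d))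
    {z : ℕ → Sph d} {s : ℕ → ℝ} {ζ : Sph d} {r : ℝ} (hz : Tendsto z atTop (𝓝 ζ))
    (hs : Tendsto s atTop (𝓝 r)) :
    Tendsto (fun n => ∫ η in gball (z n) (s n), v η ∂(sphMeasure d)) atTop
      (𝓝 (∫ η in gball ζ r, v η ∂(sphMeasure d))) := by
  simp only [← integral_indicator (gball_meas _ _)]
  apply tendsto_integral_of_dominated_convergence (fun η => ‖v η‖)
  · intro n; exact (hv.indicator (gball_meas _ _)).aestronglyMeasurable
  · exact hv.norm
  · intro n; exact ae_of_all _ fun η => norm_indicator_le_norm_self _ _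
  · filter_upwards [gsphere_null hd ζ r] with η hη
    have hg : Tendsto (fun n => geodist (z n) η) atTop (𝓝 (geodist ζ η)) :=
      geodist_tendsto η hz
    apply tendsto_const_nhds.congr'
    rcases lt_or_gt_of_ne hη with h | h
    · filter_upwards [hg.eventually_lt hs h] with n hn
      rw [Set.indicator_of_mem (show η ∈ gball ζ r from h), Set.indicator_of_mem (show η ∈ gball (z n) (s n) from hn)]
    · filter_upwards [hs.eventually_lt hg h] with n hn
      rw [Set.indicator_of_notMem (show η ∉ gball ζ r from not_lt.2 h.le),
        Set.indicator_of_notMem (show η ∉ gball (z n) (s n) from not_lt.2 hn.le)]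

lemma avg_nonneg {d : ℕ} (v : Sph d → ℝ) (B : Set (Sph d)) :
    0 ≤ ⨍ η in B, |v η| ∂(sphMeasure d) := by
  rw [setAverage_eq, smul_eq_mul]
  exact mul_nonneg (by positivity) (integral_nonneg fun _ => abs_nonneg _)

lemma avg_tri {d : ℕ} {u v : Sph d → ℝ} (hu : Integrable u (sphMeasure d))
    (hv : Integrable v (sphMeasure d)) (B : Set (Sph d)) :
    |(⨍ η in B, |u η| ∂(sphMeasure d)) - ⨍ η in B, |v η| ∂(sphMeasure d)| ≤
      ⨍ η in B, |u η - v η| ∂(sphMeasure d) := by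
  simp only [setAverage_eq, smul_eq_mul]
  rw [← mul_sub, abs_mul, abs_of_nonneg (by positivity)]
  apply mul_le_mul_of_nonneg_left _ (by positivity)
  rw [← integral_sub hu.abs.integrableOn hv.abs.integrableOn]
  refine abs_integral_le_integral_abs.trans (integral_mono_of_nonneg
      (ae_of_all _ fun _ => abs_nonneg _) (hu.sub hv).abs.integrableOn (ae_of_all _ fun η => ?_))
  exact abs_abs_sub_abs_le_abs_sub _ _

lemma polar_hgt {d : ℕ} {u : Sph d → ℝ} (h : IsPolar u) : ∀ x y : Sph d, hgt x = hgt y → u x = u y := by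
  intro x y hxy
  apply h
  rw [real_inner_comm, real_inner_comm (npole d : Euc (d+1)) (y : Euc (d+1))]
  exact hxy

lemma ae_nonpole {d : ℕ} (hd : 1 ≤ d) : ∀ᵐ ξ ∂(sphMeasure d), hgt ξ ^ 2 < 1 := by
  have h1 : ∀ᵐ ξ ∂(sphMeasure d), hgt ξ ≠ 1 := by
    rw [ae_iff]; simp only [ne_eq, not_not]; exact sph_level_null hd (npole d) 1
  have h2 : ∀ᵐ ξ ∂(sphMeasure d), hgt ξ ≠ -1 := by
    rw [ae_iff]; simp only [ne_eq, not_not]; exact sph_level_null hd (npole d) (-1)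
  filter_upwards [h1, h2] with ξ a b
  refine lt_of_le_of_ne (hgt_sq ξ) fun h => ?_
  have h3 : (hgt ξ - 1) * (hgt ξ + 1) = 0 := by linear_combination h
  rcases mul_eq_zero.1 h3 with h | h
  · exact a (by linarith)
  · exact b (by linarith)

/-- **Convergence of best balls.** If `f_j → f` in `W^{1,1}_pol(𝕊^d)` and for each `ξ` best
balls `B̄(ζ_j, r_j)` for `f_j` at `ξ` are chosen, then for a.e. `ξ`, any accumulation point
`(ζ, r)` of the sequence `(ζ_j, r_j)` gives a best ball `B̄(ζ,r)` for `f` at `ξ`. -/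
theorem best_ball_accumulation (d : ℕ) (hd : 1 ≤ d) (β : ℝ) (hβ0 : 0 < β) (hβd : β < d)
    (f : Sph d → ℝ) (g : Sph d → Euc (d + 1))
    (fj : ℕ → Sph d → ℝ) (gj : ℕ → Sph d → Euc (d + 1))
    (hf : MemW11 f g) (hfpol : IsPolar f)
    (hfj : ∀ j, MemW11 (fj j) (gj j)) (hfjpol : ∀ j, IsPolar (fj j))
    (hconv : W11Tendsto fj gj f g)
    (ζj : Sph d → ℕ → Sph d) (rj : Sph d → ℕ → ℝ) :
    ∀ᵐ ξ ∂(sphMeasure d),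
      (∀ j, IsBestBall β (fj j) ξ (ζj ξ j) (rj ξ j)) →
      ∀ (ζ : Sph d) (r : ℝ),
        MapClusterPt ((ζ, r) : Sph d × ℝ) atTop (fun j => (ζj ξ j, rj ξ j)) →
        IsBestBall β f ξ ζ r := by
  filter_upwards [ae_nonpole hd] with ξ hξ hbest ζ r hcl
  obtain ⟨C, hC0, hC⟩ := key_bound hd ξ hξ
  have hpi := Real.pi_pos
  -- uniform bound on averages
  have avgB : ∀ u G : Sph d → ℝ, WI u G → (∀ x y : Sph d, hgt x = hgt y → u x = u y) →
      ∀ (z : Sph d) (s : ℝ), 0 < s → s ≤ Real.pi → geodist z ξ ≤ s →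
      ⨍ η in gball z s, |u η| ∂(sphMeasure d) ≤
        C * (∫ η, |G η| ∂(sphMeasure d) + d * ∫ η, |u η| ∂(sphMeasure d)) := by
    intro u G hW hp z s hs0 hs1 hz
    rw [gball_eq z hs0.le hs1]
    apply hC u G hW hp z _ _ (geodist_le hs1 hz)
    have := Real.sin_pos_of_pos_of_lt_pi (x := s / 2) (by linarith) (by linarith)
    linarith
  have valB : ∀ u G : Sph d → ℝ, WI u G → (∀ x y : Sph d, hgt x = hgt y → u x = u y) →
      ∀ (z : Sph d) (s : ℝ), 0 ≤ s → s ≤ Real.pi → geodist z ξ ≤ s →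
      s ^ β * ⨍ η in gball z s, |u η| ∂(sphMeasure d) ≤ s ^ β *
        (C * (∫ η, |G η| ∂(sphMeasure d) + d * ∫ η, |u η| ∂(sphMeasure d))) := by
    intro u G hW hp z s hs0 hs1 hz
    rcases hs0.eq_or_lt with h | h
    · rw [← h, Real.zero_rpow hβ0.ne']; simp
    · exact mul_le_mul_of_nonneg_left (avgB u G hW hp z s h hs1 hz) (Real.rpow_nonneg hs0 _)
  have N0 : ∀ u G : Sph d → ℝ,
      0 ≤ C * (∫ η, |G η| ∂(sphMeasure d) + d * ∫ η, |u η| ∂(sphMeasure d)) := by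
    intro u G
    exact mul_nonneg hC0 (add_nonneg (integral_nonneg fun _ => abs_nonneg _)
      (mul_nonneg (Nat.cast_nonneg d) (integral_nonneg fun _ => abs_nonneg _)))
  have powle : ∀ s : ℝ, 0 ≤ s → s ≤ Real.pi → s ^ β ≤ Real.pi ^ β := fun s h0 h1 =>
    Real.rpow_le_rpow h0 h1 hβ0.le
  set e : Euc (d+1) := (npole d).1 with he
  set G : Sph d → ℝ := fun η => ⟪e, g η⟫ with hG
  set Gj : ℕ → Sph d → ℝ := fun j η => ⟪e, gj j η⟫ with hGj
  have hWf : WI f G := WI_of hf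
  have hWj : ∀ j, WI (fj j) (Gj j) := fun j => WI_of (hfj j)
  have hWd : ∀ j, WI (fun η => fj j η - f η) (fun η => Gj j η - G η) := fun j => WI_sub (hWj j) hWf
  have pf := polar_hgt hfpol
  have pj := fun j => polar_hgt (hfjpol j)
  have pd : ∀ j, ∀ x y : Sph d, hgt x = hgt y → fj j x - f x = fj j y - f y := fun j x y h => by
    rw [pf x y h, pj j x y h]
  -- the error
  set ε : ℕ → ℝ := fun j => Real.pi ^ β * (C * (∫ η, |Gj j η - G η| ∂(sphMeasure d) +
    d * ∫ η, |fj j η - f η| ∂(sphMeasure d))) with hε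
  have hε0 : Tendsto ε atTop (𝓝 0) := by
    have h1 : Tendsto (fun j => Real.pi ^ β * (C * ((1 + d) * ((∫ ξ, |fj j ξ - f ξ| ∂(sphMeasure d)) +
        ∫ ξ, ‖gj j ξ - g ξ‖ ∂(sphMeasure d))))) atTop (𝓝 0) := by
      have := ((hconv.const_mul ((1:ℝ) + d)).const_mul C).const_mul (Real.pi ^ β)
      simpa using this
    refine squeeze_zero (fun j => mul_nonneg (by positivity) (N0 (fun η => fj j η - f η) _)) (fun j => ?_) h1
    have a1 : ∫ η, |Gj j η - G η| ∂(sphMeasure d) ≤ ∫ ξ, ‖gj j ξ - g ξ‖ ∂(sphMeasure d) := by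
      refine integral_mono_of_nonneg (ae_of_all _ fun _ => abs_nonneg _)
        ((hfj j).2.1.sub hf.2.1).norm (ae_of_all _ fun η => ?_)
      have := abs_real_inner_le_norm e (gj j η - g η)
      have he1 : ‖e‖ = 1 := sph_norm _
      rwa [he1, one_mul, inner_sub_right] at this
    have a2 : 0 ≤ ∫ ξ, |fj j ξ - f ξ| ∂(sphMeasure d) := integral_nonneg fun _ => abs_nonneg _
    have a3 : 0 ≤ ∫ ξ, ‖gj j ξ - g ξ‖ ∂(sphMeasure d) := integral_nonneg fun _ => norm_nonneg _
    have hd0 : (0:ℝ) ≤ d := Nat.cast_nonneg d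
    simp only [hε]
    gcongr
    nlinarith
  have Fdiff : ∀ j (z : Sph d) (s : ℝ), 0 ≤ s → s ≤ Real.pi → geodist z ξ ≤ s →
      |s ^ β * (⨍ η in gball z s, |fj j η| ∂(sphMeasure d)) -
        s ^ β * ⨍ η in gball z s, |f η| ∂(sphMeasure d)| ≤ ε j := by
    intro j z s h0 h1 hz
    rw [← mul_sub, abs_mul, abs_of_nonneg (Real.rpow_nonneg h0 _)]
    refine (mul_le_mul_of_nonneg_left (avg_tri (hWj j).1 hWf.1 _) (Real.rpow_nonneg h0 _)).trans ?_
    refine (valB _ _ (hWd j) (pd j) z s h0 h1 hz).trans ?_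
    exact mul_le_mul_of_nonneg_right (powle s h0 h1) (N0 (fun η => fj j η - f η) _)
  have bdd : ∀ u G : Sph d → ℝ, WI u G → (∀ x y : Sph d, hgt x = hgt y → u x = u y) →
      BddAbove {a | ∃ ζ : Sph d, ∃ r : ℝ, 0 < r ∧ r ≤ Real.pi ∧ geodist ζ ξ ≤ r ∧
        a = r ^ β * ⨍ η in gball ζ r, |u η| ∂(sphMeasure d)} := by
    intro u G hW hp
    refine ⟨Real.pi ^ β * (C * (∫ η, |G η| ∂(sphMeasure d) + d * ∫ η, |u η| ∂(sphMeasure d))), ?_⟩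
    rintro _ ⟨z, s, h0, h1, hz, rfl⟩
    exact (valB u G hW hp z s h0.le h1 hz).trans
      (mul_le_mul_of_nonneg_right (powle s h0.le h1) (N0 u G))
  have nonem : ∀ u : Sph d → ℝ, Set.Nonempty {a | ∃ ζ : Sph d, ∃ r : ℝ, 0 < r ∧ r ≤ Real.pi ∧
      geodist ζ ξ ≤ r ∧ a = r ^ β * ⨍ η in gball ζ r, |u η| ∂(sphMeasure d)} := fun u =>
    ⟨_, ξ, Real.pi, hpi, le_rfl, Real.arccos_le_pi _, rfl⟩
  have Mdiff : ∀ j, |sphMax β (fj j) ξ - sphMax β f ξ| ≤ ε j := by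
    intro j
    rw [abs_le]
    constructor
    · have : sphMax β f ξ ≤ sphMax β (fj j) ξ + ε j := by
        apply csSup_le (nonem f)
        rintro _ ⟨z, s, h0, h1, hz, rfl⟩
        have a := le_csSup (bdd _ _ (hWj j) (pj j)) ⟨z, s, h0, h1, hz, rfl⟩
        have b := (abs_le.1 (Fdiff j z s h0.le h1 hz)).1
        unfold sphMax
        linarith
      linarith
    · have : sphMax β (fj j) ξ ≤ sphMax β f ξ + ε j := by
        apply csSup_le (nonem (fj j))
        rintro _ ⟨z, s, h0, h1, hz, rfl⟩
        have a := le_csSup (bdd _ _ hWf pf) ⟨z, s, h0, h1, hz, rfl⟩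
        have b := (abs_le.1 (Fdiff j z s h0.le h1 hz)).2
        unfold sphMax
        linarith
      linarith
  have Flim : Tendsto (fun j => (rj ξ j) ^ β * ⨍ η in gball (ζj ξ j) (rj ξ j), |f η| ∂(sphMeasure d))
      atTop (𝓝 (sphMax β f ξ)) := by
    rw [tendsto_iff_dist_tendsto_zero]
    have h2 : Tendsto (fun j => 2 * ε j) atTop (𝓝 0) := by simpa using hε0.const_mul 2
    refine squeeze_zero (fun _ => dist_nonneg) (fun j => ?_) h2
    obtain ⟨h0, h1, hz, hm⟩ := hbest j
    have a := Fdiff j _ _ h0 h1 hz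
    have b := Mdiff j
    rw [← hm] at a
    rw [Real.dist_eq]
    rw [abs_le] at a b ⊢
    constructor <;> linarith
  obtain ⟨φ, hφ, hlim⟩ := hcl.tendsto_subseq
  have hzlim : Tendsto (fun n => ζj ξ (φ n)) atTop (𝓝 ζ) := (continuous_fst.tendsto _).comp hlim
  have hrlim : Tendsto (fun n => rj ξ (φ n)) atTop (𝓝 r) := (continuous_snd.tendsto _).comp hlim
  have hr0 : 0 ≤ r := ge_of_tendsto' hrlim fun n => (hbest _).1
  have hr1 : r ≤ Real.pi := le_of_tendsto' hrlim fun n => (hbest _).2.1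
  have hg : Tendsto (fun n => geodist (ζj ξ (φ n)) ξ) atTop (𝓝 (geodist ζ ξ)) :=
    geodist_tendsto ξ hzlim
  have hgle : geodist ζ ξ ≤ r := le_of_tendsto_of_tendsto' hg hrlim fun n => (hbest _).2.2.1
  refine ⟨hr0, hr1, hgle, ?_⟩
  have Fsub := Flim.comp hφ.tendsto_atTop
  have hpow : Tendsto (fun n => (rj ξ (φ n)) ^ β) atTop (𝓝 (r ^ β)) :=
    hrlim.rpow_const (Or.inr hβ0.le)
  refine tendsto_nhds_unique Fsub ?_
  rcases hr0.eq_or_lt with h | h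
  · rw [← h, Real.zero_rpow hβ0.ne', zero_mul]
    rw [← h, Real.zero_rpow hβ0.ne'] at hpow
    have h3 := hpow.mul_const (C * (∫ η, |G η| ∂(sphMeasure d) + d * ∫ η, |f η| ∂(sphMeasure d)))
    rw [zero_mul] at h3
    refine squeeze_zero (fun n => ?_) (fun n => ?_) h3
    · exact mul_nonneg (Real.rpow_nonneg (hbest _).1 _) (avg_nonneg _ _)
    · exact valB f G hWf pf _ _ (hbest _).1 (hbest _).2.1 (hbest _).2.2.1
  · apply hpow.mul
    simp only [setAverage_eq, smul_eq_mul]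
    refine Tendsto.mul ?_ (ball_int_cont hd hWf.1.abs hzlim hrlim)
    have hm : Tendsto (fun n => (sphMeasure d).real (gball (ζj ξ (φ n)) (rj ξ (φ n)))) atTop
        (𝓝 ((sphMeasure d).real (gball ζ r))) := by
      have := ball_int_cont hd (integrable_const (1:ℝ)) hzlim hrlim
      simpa using this
    apply hm.inv₀
    obtain ⟨c, hc, hlow⟩ := sph_lower hd
    have hs : 0 < 2 * Real.sin (r / 2) := by
      have := Real.sin_pos_of_pos_of_lt_pi (x := r / 2) (by linarith) (by linarith)
      linarith
    rw [gball_eq ζ h.le hr1]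
    have h5 := hlow ζ (min (2 * Real.sin (r / 2)) 1) (lt_min hs one_pos) (min_le_right _ _)
    have h6 : (sphMeasure d).real (ball ζ (min (2 * Real.sin (r / 2)) 1)) ≤
      (sphMeasure d).real (ball ζ (2 * Real.sin (r / 2))) :=
      measureReal_mono (ball_subset_ball (min_le_left _ _))
    have h7 : 0 < c * (min (2 * Real.sin (r / 2)) 1) ^ d :=
      mul_pos hc (pow_pos (lt_min hs one_pos) _)
    linarith

end
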